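/- arXiv:1909.13680 — 2 statements merged into one kernel-verified Lean document; each statement's English description precedes it below -/
import Mathlib

section
/- Fix real numbers a < b, α ∈ (0,1), β ∈ [0,1], and set γ = α + β(1−α). Let f : (a,b]×ℝ → ℝ be such that t ↦ f(t, z(t)) belongs to C_{1−γ}[a,b] for every z ∈ C_{1−γ}[a,b], and let y_a ∈ ℝ. Then a function z ∈ C^γ_{1−γ}[a,b] satisfies the initial value problem D^{α,β}_a z(t) = f(t, z(t)) for all t ∈ (a,b] together with lim_{t→a^+}(I^{1−γ}_a z)(t) = y_a, if and only if z satisfies the Volterra integral equation z(t) = (y_a/Γ(γ)) (t−a)^{γ−1} + (1/Γ(α)) ∫_a^t (t−s)^{α−1} f(s, z(s)) ds for all t ∈ (a,b]. -/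
/-- The Riemann–Liouville fractional integral of order `μ` based at `a`:
`(I^μ_a g)(t) = (1/Γ(μ)) ∫_a^t (t−s)^{μ−1} g(s) ds` for `μ > 0`
(with the usual convention `I⁰_a = id` in the degenerate case `μ = 0`). -/
noncomputable def rlInt (a μ : ℝ) (g : ℝ → ℝ) (t : ℝ) : ℝ :=
  if μ = 0 then g t
  else (1 / Real.Gamma μ) * ∫ s in a..t, (t - s) ^ (μ - 1) * g s

/-- Membership in the weighted space `C_w[a,b]`: `g : (a,b] → ℝ` is such that
`t ↦ (t−a)^w g(t)` extends to a continuous function on `[a,b]`. -/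
def memCw (a b w : ℝ) (g : ℝ → ℝ) : Prop :=
  ∃ G : ℝ → ℝ, ContinuousOn G (Set.Icc a b) ∧
    ∀ t ∈ Set.Ioc a b, G t = (t - a) ^ w * g t


open MeasureTheory Set Filter Topology

lemma icongr {E : Type*} [NormedAddCommGroup E] [NormedSpace ℝ E] {x y : ℝ} (h : x ≤ y) {f g : ℝ → E} (hfg : ∀ u ∈ Ioc x y, f u = g u) :
    ∫ u in x..y, f u = ∫ u in x..y, g u := by
  rw [intervalIntegral.integral_of_le h, intervalIntegral.integral_of_le h]
  exact setIntegral_congr_fun measurableSet_Ioc hfg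

lemma kb_complex (p q : ℝ) (x : ℝ) (hx : x ∈ Ioc (0:ℝ) 1) :
    ((x:ℂ) ^ ((q:ℂ) - 1) * (1 - (x:ℂ)) ^ ((p:ℂ) - 1)) =
      (((1 - x) ^ (p - 1) * x ^ (q - 1) : ℝ) : ℂ) := by
  rw [Complex.ofReal_mul, Complex.ofReal_cpow (by linarith [hx.2]), Complex.ofReal_cpow hx.1.le]
  push_cast
  ring

lemma kb_int {p q : ℝ} (hp : 0 < p) (hq : 0 < q) :
    IntervalIntegrable (fun u : ℝ => (1 - u) ^ (p - 1) * u ^ (q - 1)) volume 0 1 := by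
  have h := Complex.betaIntegral_convergent (u := (q:ℂ)) (v := (p:ℂ)) (by simpa) (by simpa)
  rw [intervalIntegrable_iff_integrableOn_Ioc_of_le zero_le_one] at h ⊢
  have h2 : IntegrableOn (fun x : ℝ => (((1 - x) ^ (p - 1) * x ^ (q - 1) : ℝ) : ℂ)) (Ioc 0 1) :=
    h.congr_fun (fun x hx => kb_complex p q x hx) measurableSet_Ioc
  have h3 := Integrable.re h2
  simpa [IntegrableOn] using h3

lemma kb_val {p q : ℝ} (hp : 0 < p) (hq : 0 < q) :
    ∫ u in (0:ℝ)..1, (1 - u) ^ (p - 1) * u ^ (q - 1)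
      = Real.Gamma p * Real.Gamma q / Real.Gamma (p + q) := by
  have h := ProbabilityTheory.beta_eq_betaIntegralReal q p hq hp
  have h2 : Complex.betaIntegral q p =
      ((∫ u in (0:ℝ)..1, (1 - u) ^ (p - 1) * u ^ (q - 1) : ℝ) : ℂ) := by
    rw [Complex.betaIntegral, ← intervalIntegral.integral_ofReal]
    refine icongr zero_le_one fun x hx => ?_
    exact kb_complex p q x hx
  rw [h2, Complex.ofReal_re, ProbabilityTheory.beta] at h
  rw [← h, mul_comm, add_comm]

lemma ker_int {p q r t : ℝ} (hp : 0 < p) (hq : 0 < q) (hrt : r < t) :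
    IntervalIntegrable (fun s : ℝ => (t - s) ^ (p - 1) * (s - r) ^ (q - 1)) volume r t := by
  have h0 : 0 < t - r := sub_pos.2 hrt
  have h := ((kb_int hp hq).comp_mul_left (c := (t - r)⁻¹)).comp_sub_right r
  have e : 1 / (t - r)⁻¹ + r = t := by field_simp; ring
  rw [zero_div, zero_add, e] at h
  have h2 := h.const_mul ((t - r) ^ (p - 1) * (t - r) ^ (q - 1))
  refine h2.congr_uIoo ?_
  rw [uIoo_of_le hrt.le]
  intro s hs
  have h1 : t - s = (t - r) * (1 - (t - r)⁻¹ * (s - r)) := by field_simp; ring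
  have h1' : 0 ≤ (1 - (t - r)⁻¹ * (s - r)) := by
    have : 0 ≤ (t - r) * (1 - (t - r)⁻¹ * (s - r)) := by rw [← h1]; linarith [hs.2]
    exact nonneg_of_mul_nonneg_right this h0
  have h3 : s - r = (t - r) * ((t - r)⁻¹ * (s - r)) := by field_simp
  have h3' : 0 ≤ (t - r)⁻¹ * (s - r) := mul_nonneg (inv_nonneg.2 h0.le) (by linarith [hs.1])
  show _ = (t - s) ^ (p - 1) * (s - r) ^ (q - 1)
  have e1 := Real.mul_rpow (z := p - 1) h0.le h1'
  have e2 := Real.mul_rpow (z := q - 1) h0.le h3'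
  rw [← h1] at e1
  rw [← h3] at e2
  rw [e1, e2]
  ring

lemma scale_int {p r t : ℝ} (hrt : r < t) (φ : ℝ → ℝ) :
    ∫ s in r..t, (t - s) ^ (p - 1) * φ s =
      (t - r) ^ p * ∫ u in (0:ℝ)..1, (1 - u) ^ (p - 1) * φ (r + (t - r) * u) := by
  have h0 : 0 < t - r := sub_pos.2 hrt
  have h := intervalIntegral.smul_integral_comp_add_mul (a := 0) (b := 1)
    (fun s => (t - s) ^ (p - 1) * φ s) (t - r) r
  have e : r + (t - r) * 1 = t := by ring
  rw [mul_zero, add_zero, e] at h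
  rw [← h, smul_eq_mul]
  have : (t - r) ^ p = (t - r) * (t - r) ^ (p - 1) := by
    rw [Real.rpow_sub_one h0.ne']; field_simp
  rw [this, mul_assoc, ← intervalIntegral.integral_const_mul ((t - r) ^ (p - 1))]
  congr 1
  apply intervalIntegral.integral_congr
  intro u hu
  rw [uIcc_of_le zero_le_one] at hu
  have : t - (r + (t - r) * u) = (t - r) * (1 - u) := by ring
  simp only []
  rw [this, Real.mul_rpow h0.le (by linarith [hu.2])]
  ring

lemma ker_val {p q r t : ℝ} (hp : 0 < p) (hq : 0 < q) (hrt : r < t) :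
    ∫ s in r..t, (t - s) ^ (p - 1) * (s - r) ^ (q - 1)
      = Real.Gamma p * Real.Gamma q / Real.Gamma (p + q) * (t - r) ^ (p + q - 1) := by
  have h0 : 0 < t - r := sub_pos.2 hrt
  rw [scale_int hrt, ← kb_val hp hq, show p + q - 1 = p + (q - 1) by ring, Real.rpow_add h0,
    ← mul_assoc, mul_comm _ ((t - r) ^ p), mul_assoc]
  congr 1
  rw [mul_comm _ ((t - r) ^ (q - 1)), ← intervalIntegral.integral_const_mul]
  apply intervalIntegral.integral_congr
  intro u hu
  rw [uIcc_of_le zero_le_one] at hu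
  have : r + (t - r) * u - r = (t - r) * u := by ring
  simp only []
  rw [this, Real.mul_rpow h0.le hu.1]
  ring

lemma memCw_eq {a b w : ℝ} {g G : ℝ → ℝ} (hG : ∀ t ∈ Ioc a b, G t = (t - a) ^ w * g t)
    {s : ℝ} (hs : s ∈ Ioc a b) : g s = (s - a) ^ ((1 - w) - 1) * G s := by
  have h0 : 0 < s - a := sub_pos.2 hs.1
  rw [hG s hs, ← mul_assoc, ← Real.rpow_add h0]
  simp

lemma memCw_int {a b w p t : ℝ} {g : ℝ → ℝ} (hg : memCw a b w g) (hw : w < 1) (hp : 0 < p)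
    (ht : t ∈ Ioc a b) :
    IntervalIntegrable (fun s => (t - s) ^ (p - 1) * g s) volume a t := by
  obtain ⟨G, hGc, hG⟩ := hg
  have h := (ker_int hp (sub_pos.2 hw) ht.1).mul_continuousOn (g := G)
    (hGc.mono (by rw [uIcc_of_le ht.1.le]; exact Icc_subset_Icc_right ht.2))
  refine h.congr_uIoo ?_
  rw [uIoo_of_le ht.1.le]
  intro s hs
  simp only []
  rw [memCw_eq hG ⟨hs.1, hs.2.le.trans ht.2⟩, mul_assoc]

lemma memCw_int1 {a b w t : ℝ} {g : ℝ → ℝ} (hg : memCw a b w g) (hw : w < 1) 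
    (ht : t ∈ Ioc a b) : IntervalIntegrable g volume a t := by
  simpa using memCw_int hg hw zero_lt_one ht

lemma memCw_rlInt {a b w p : ℝ} {g : ℝ → ℝ} (hab : a < b) (hg : memCw a b w g) (hw : w < 1)
    (hp : 0 ≤ p) : memCw a b (w - p) (rlInt a p g) := by
  rcases hp.eq_or_lt with rfl | hp
  · obtain ⟨G, hGc, hG⟩ := hg
    exact ⟨G, hGc, fun t ht => by simpa [rlInt] using hG t ht⟩
  obtain ⟨G, hGc, hG⟩ := hg
  refine ⟨fun t => 1 / Real.Gamma p *
    ∫ u in (0:ℝ)..1, ((1 - u) ^ (p - 1) * u ^ ((1 - w) - 1)) * IccExtend hab.le (domRestrict (Icc a b) G) (a + (t - a) * u), ?_, ?_⟩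
  · apply Continuous.continuousOn
    apply Continuous.mul continuous_const
    have hc : Continuous (IccExtend hab.le (domRestrict (Icc a b) G)) :=
      (continuousOn_iff_continuous_domRestrict.1 hGc).Icc_extend'
    obtain ⟨C, hC⟩ : ∃ C, ∀ x, ‖IccExtend hab.le (domRestrict (Icc a b) G) x‖ ≤ C := by
      obtain ⟨C, hC⟩ := isCompact_Icc.exists_bound_of_continuousOn hGc
      exact ⟨C, fun x => hC _ (projIcc a b hab.le x).2⟩
    have hk := kb_int hp (sub_pos.2 hw)
    refine intervalIntegral.continuous_of_dominated_interval
      (bound := fun u => ‖(1 - u) ^ (p - 1) * u ^ ((1 - w) - 1)‖ * C) ?_ ?_ ?_ ?_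
    · intro x
      rw [uIoc_of_le zero_le_one]
      exact hk.1.1.mul (by fun_prop)
    · intro x
      refine Eventually.of_forall fun u _ => ?_
      rw [norm_mul]
      exact mul_le_mul_of_nonneg_left (hC _) (norm_nonneg _)
    · exact hk.norm.mul_const C
    · refine Eventually.of_forall fun u _ => ?_
      fun_prop
  · intro t ht
    have h0 : 0 < t - a := sub_pos.2 ht.1
    rw [rlInt, if_neg hp.ne', scale_int ht.1]
    simp only []
    rw [show ∀ x y z v : ℝ, x * (y * (z * v)) = y * ((x * z) * v) by intros; ring,
      ← Real.rpow_add h0]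
    congr 1
    rw [← intervalIntegral.integral_const_mul]
    refine icongr zero_le_one fun u hu => ?_
    have hm : a + (t - a) * u ∈ Ioc a b := by
      constructor
      · nlinarith [hu.1]
      · nlinarith [hu.2, ht.2]
    rw [IccExtend_of_mem _ _ ⟨hm.1.le, hm.2⟩, memCw_eq hG hm]
    have : a + (t - a) * u - a = (t - a) * u := by ring
    rw [this, Real.mul_rpow h0.le hu.1.le, domRestrict_apply,
      show ∀ x y z v k : ℝ, x * (y * (z * v * k)) = (x * z) * (y * v * k) by intros; ring,
      ← Real.rpow_add h0]
    simp

lemma rl_semigroup_pos {a b w p q t : ℝ} {g : ℝ → ℝ} (hg : memCw a b w g) (hw : w < 1)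
    (hp : 0 < p) (hq : 0 < q) (ht : t ∈ Ioc a b) :
    ∫ s in a..t, (t - s) ^ (p - 1) * ∫ r in a..s, (s - r) ^ (q - 1) * g r =
      Real.Gamma p * Real.Gamma q / Real.Gamma (p + q) *
        ∫ r in a..t, (t - r) ^ (p + q - 1) * g r := by
  set B := Real.Gamma p * Real.Gamma q / Real.Gamma (p + q) with hB
  set φ : ℝ → ℝ → ℝ := fun s r => (t - s) ^ (p - 1) * ((s - r) ^ (q - 1) * g r) with hφ
  set F : ℝ → ℝ → ℝ := fun s r => (Iio s).indicator (φ s) r with hF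
  set m : Measure ℝ := volume.restrict (Ioo a t) with hm
  have hF2 : ∀ s r, F s r = (Ioi r).indicator (fun s => φ s r) s := by
    intro s r
    simp only [hF, indicator, mem_Iio, mem_Ioi]
  have i1 : ∀ s ∈ Ioo a t, ∫ r, F s r ∂m = (t - s) ^ (p - 1) * ∫ r in a..s, (s - r) ^ (q - 1) * g r := by
    intro s hs
    rw [hm, setIntegral_indicator measurableSet_Iio, Ioo_inter_Iio, min_eq_right hs.2.le,
      intervalIntegral.integral_of_le hs.1.le, integral_Ioc_eq_integral_Ioo, integral_const_mul]
  have key : ∀ r ∈ Ioo a t, IntegrableOn (fun s => (t - s) ^ (p - 1) * (s - r) ^ (q - 1)) (Ioo r t) := by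
    intro r hr
    have := ker_int hp hq hr.2
    rwa [intervalIntegrable_iff_integrableOn_Ioo_of_le hr.2.le] at this
  have kv : ∀ r ∈ Ioo a t, ∫ s in Ioo r t, (t - s) ^ (p - 1) * (s - r) ^ (q - 1) =
      B * (t - r) ^ (p + q - 1) := by
    intro r hr
    rw [← ker_val hp hq hr.2, intervalIntegral.integral_of_le hr.2.le,
      integral_Ioc_eq_integral_Ioo]
  have hset : ∀ r ∈ Ioo a t, Ioo a t ∩ Ioi r = Ioo r t := by
    intro r hr
    ext x
    simp only [mem_inter_iff, mem_Ioo, mem_Ioi]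
    constructor
    · rintro ⟨⟨_, h⟩, h'⟩; exact ⟨h', h⟩
    · rintro ⟨h, h'⟩; exact ⟨⟨hr.1.trans h, h'⟩, h⟩
  have i2 : ∀ r ∈ Ioo a t, ∫ s, F s r ∂m = B * ((t - r) ^ (p + q - 1) * g r) := by
    intro r hr
    simp_rw [hF2]
    rw [hm, setIntegral_indicator measurableSet_Ioi, hset r hr, ← mul_assoc, ← kv r hr,
      ← integral_mul_const]
    simp only [hφ, mul_assoc]
  have i3 : ∀ r ∈ Ioo a t, ∫ s, ‖F s r‖ ∂m = B * ‖((t - r) ^ (p + q - 1) * g r)‖ := by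
    intro r hr
    simp_rw [hF2, norm_indicator_eq_indicator_norm]
    rw [hm, setIntegral_indicator measurableSet_Ioi, hset r hr, norm_mul,
      Real.norm_of_nonneg (Real.rpow_nonneg (by linarith [hr.2]) _), ← mul_assoc, ← kv r hr,
      ← integral_mul_const]
    refine setIntegral_congr_fun measurableSet_Ioo fun s hs => ?_
    simp only [hφ, norm_mul, mul_assoc]
    rw [Real.norm_of_nonneg (Real.rpow_nonneg (by linarith [hs.2]) _),
      Real.norm_of_nonneg (Real.rpow_nonneg (by linarith [hs.1]) _)]
  have i4 : ∀ r ∈ Ioo a t, Integrable (fun s => F s r) m := by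
    intro r hr
    simp_rw [hF2]
    rw [hm, integrable_indicator_iff measurableSet_Ioi, IntegrableOn,
      Measure.restrict_restrict measurableSet_Ioi, inter_comm, hset r hr]
    have := (key r hr).mul_const (g r)
    simpa only [hφ, mul_assoc, IntegrableOn] using this
  have hgm : AEStronglyMeasurable g m := by
    have := memCw_int1 hg hw ht
    rw [intervalIntegrable_iff_integrableOn_Ioo_of_le ht.1.le] at this
    exact this.1
  have hint := memCw_int hg hw (add_pos hp hq) ht
  rw [intervalIntegrable_iff_integrableOn_Ioo_of_le ht.1.le] at hint
  have hFm : AEStronglyMeasurable (Function.uncurry F) (m.prod m) := by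
    have : Function.uncurry F = {x : ℝ × ℝ | x.2 < x.1}.indicator (fun x => φ x.1 x.2) := by
      ext ⟨s, r⟩
      simp [hF, Function.uncurry, indicator]
    rw [this]
    refine AEStronglyMeasurable.indicator ?_ (measurableSet_lt measurable_snd measurable_fst)
    have h1 : Measurable (fun x : ℝ × ℝ => (t - x.1) ^ (p - 1)) := by fun_prop
    have h2 : Measurable (fun x : ℝ × ℝ => (x.1 - x.2) ^ (q - 1)) := by fun_prop
    exact h1.aestronglyMeasurable.mul (h2.aestronglyMeasurable.mul hgm.comp_snd)
  have hFi : Integrable (Function.uncurry F) (m.prod m) := by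
    rw [integrable_prod_iff' hFm]
    constructor
    · exact (ae_restrict_iff' measurableSet_Ioo).2 (Eventually.of_forall i4)
    · have h : Integrable (fun r => B * ‖((t - r) ^ (p + q - 1) * g r)‖) m := hint.norm.const_mul B
      refine h.congr ?_
      exact (ae_restrict_iff' measurableSet_Ioo).2 (Eventually.of_forall fun r hr => (i3 r hr).symm)
  have hsw := integral_integral_swap hFi
  rw [setIntegral_congr_fun measurableSet_Ioo i1, setIntegral_congr_fun measurableSet_Ioo i2,
    integral_const_mul] at hsw
  rw [intervalIntegral.integral_of_le ht.1.le, intervalIntegral.integral_of_le ht.1.le,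
    integral_Ioc_eq_integral_Ioo, integral_Ioc_eq_integral_Ioo]
  exact hsw

lemma rl_semigroup {a b w p q t : ℝ} {g : ℝ → ℝ} (hg : memCw a b w g) (hw : w < 1)
    (hp : 0 ≤ p) (hq : 0 ≤ q) (ht : t ∈ Ioc a b) :
    rlInt a p (rlInt a q g) t = rlInt a (p + q) g t := by
  rcases hp.eq_or_lt with rfl | hp
  · simp [rlInt]
  rcases hq.eq_or_lt with rfl | hq
  · simp [rlInt]
  have h := rl_semigroup_pos hg hw hp hq ht
  simp only [rlInt, hp.ne', hq.ne', (add_pos hp hq).ne', if_false]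
  have e : ∀ s, (t - s) ^ (p - 1) * (1 / Real.Gamma q * ∫ r in a..s, (s - r) ^ (q - 1) * g r) =
    1 / Real.Gamma q * ((t - s) ^ (p - 1) * ∫ r in a..s, (s - r) ^ (q - 1) * g r) := by
    intro s; ring
  simp_rw [e]
  rw [intervalIntegral.integral_const_mul, h]
  have := (Real.Gamma_pos_of_pos hp).ne'
  have := (Real.Gamma_pos_of_pos hq).ne'
  field_simp

lemma rl_congr {a b p t : ℝ} {g h : ℝ → ℝ} (hgh : ∀ s ∈ Ioc a b, g s = h s) (ht : t ∈ Ioc a b) :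
    rlInt a p g t = rlInt a p h t := by
  unfold rlInt
  split_ifs
  · exact hgh t ht
  · congr 1
    refine icongr ht.1.le fun s hs => ?_
    rw [hgh s ⟨hs.1, hs.2.trans ht.2⟩]

lemma rl_add {a b w p t : ℝ} {g h : ℝ → ℝ} (hg : memCw a b w g) (hh : memCw a b w h) (hw : w < 1)
    (hp : 0 ≤ p) (ht : t ∈ Ioc a b) :
    rlInt a p (fun s => g s + h s) t = rlInt a p g t + rlInt a p h t := by
  rcases hp.eq_or_lt with rfl | hp
  · simp [rlInt]
  simp only [rlInt, hp.ne', if_false, mul_add]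
  rw [intervalIntegral.integral_add (memCw_int hg hw hp ht) (memCw_int hh hw hp ht), mul_add]

/-- `I^p` of a normalized power. -/
lemma rl_pow {a b p q c t : ℝ} (hp : 0 ≤ p) (hq : 0 < q) (ht : t ∈ Ioc a b) :
    rlInt a p (fun s => c / Real.Gamma q * (s - a) ^ (q - 1)) t =
      c / Real.Gamma (p + q) * (t - a) ^ (p + q - 1) := by
  rcases hp.eq_or_lt with rfl | hp
  · simp [rlInt]
  simp only [rlInt, hp.ne', if_false]
  have e : ∀ s, (t - s) ^ (p - 1) * (c / Real.Gamma q * (s - a) ^ (q - 1)) =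
    c / Real.Gamma q * ((t - s) ^ (p - 1) * (s - a) ^ (q - 1)) := by
    intro s; ring
  simp_rw [e]
  rw [intervalIntegral.integral_const_mul, ker_val hp hq ht.1]
  have := (Real.Gamma_pos_of_pos hp).ne'
  have := (Real.Gamma_pos_of_pos hq).ne'
  field_simp

lemma memCw_mono {a b w v : ℝ} {g : ℝ → ℝ} (hg : memCw a b w g) (hwv : w ≤ v) :
    memCw a b v g := by
  obtain ⟨G, hGc, hG⟩ := hg
  refine ⟨fun t => (t - a) ^ (v - w) * G t, ?_, ?_⟩
  · refine ContinuousOn.mul ?_ hGc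
    refine ContinuousOn.rpow_const (by fun_prop) fun x _ => Or.inr (by linarith)
  · intro t ht
    have h0 : 0 < t - a := sub_pos.2 ht.1
    simp only []
    rw [hG t ht, ← mul_assoc, ← Real.rpow_add h0]
    simp

lemma memCw_pow {a b c q : ℝ} : memCw a b (1 - q) (fun s => c * (s - a) ^ (q - 1)) := by
  refine ⟨fun _ => c, continuousOn_const, fun t ht => ?_⟩
  have h0 : 0 < t - a := sub_pos.2 ht.1
  rw [mul_left_comm, ← Real.rpow_add h0]
  simp

lemma memCw_add {a b w : ℝ} {g h : ℝ → ℝ} (hg : memCw a b w g) (hh : memCw a b w h) :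
    memCw a b w (fun s => g s + h s) := by
  obtain ⟨G, hGc, hG⟩ := hg
  obtain ⟨H, hHc, hH⟩ := hh
  refine ⟨fun t => G t + H t, hGc.add hHc, fun t ht => ?_⟩
  simp only []
  rw [hG t ht, hH t ht, mul_add]

lemma memCw_cont {a b w : ℝ} {g : ℝ → ℝ} (hg : memCw a b w g) : ContinuousOn g (Ioc a b) := by
  obtain ⟨G, hGc, hG⟩ := hg
  have : ContinuousOn (fun s => (s - a) ^ ((1 - w) - 1) * G s) (Ioc a b) := by
    refine ContinuousOn.mul ?_ (hGc.mono Ioc_subset_Icc_self)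
    refine ContinuousOn.rpow_const (by fun_prop) fun x hx => Or.inl (by linarith [hx.1])
  exact this.congr fun s hs => memCw_eq hG hs

lemma memCw_tendsto {a b w : ℝ} {g : ℝ → ℝ} (hab : a < b) (hg : memCw a b w g) (hw : w < 0) :
    Tendsto g (𝓝[>] a) (𝓝 0) := by
  obtain ⟨G, hGc, hG⟩ := hg
  have h1 : ContinuousOn (fun s => (s - a) ^ (-w) * G s) (Icc a b) := by
    refine ContinuousOn.mul ?_ hGc
    refine ContinuousOn.rpow_const (by fun_prop) fun x hx => Or.inr (by linarith)
  have h2 := (h1 a ⟨le_rfl, hab.le⟩).tendsto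
  simp only [sub_self, Real.zero_rpow (neg_pos.2 hw).ne', zero_mul] at h2
  rw [← nhdsWithin_Ioc_eq_nhdsGT hab]
  refine (h2.mono_left (nhdsWithin_mono a Ioc_subset_Icc_self)).congr' ?_
  filter_upwards [self_mem_nhdsWithin] with s hs
  rw [memCw_eq hG hs]; congr 2; ring

lemma rl_one {a t : ℝ} {g : ℝ → ℝ} : rlInt a 1 g t = ∫ s in a..t, g s := by
  simp [rlInt]

lemma rl_one_inj {a b w : ℝ} {g h : ℝ → ℝ} (hg : memCw a b w g) (hh : memCw a b w h) (hw : w < 1)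
    (heq : ∀ t ∈ Ioc a b, rlInt a 1 g t = rlInt a 1 h t) : ∀ t ∈ Ioc a b, g t = h t := by
  intro t ht
  have D : ∀ {k : ℝ → ℝ}, memCw a b w k →
      HasDerivWithinAt (fun u => ∫ s in a..u, k s) (k t) (Iic t) t := by
    intro k hk
    have hmem : Ioc a b ∈ 𝓝[≤] t :=
      mem_of_superset (Ioc_mem_nhdsLE ht.1) (Ioc_subset_Ioc_right ht.2)
    refine intervalIntegral.integral_hasDerivWithinAt_right (memCw_int1 hk hw ht) (t := Iic t) ?_ ?_
    · exact ⟨Ioc a b, hmem, (memCw_cont hk).aestronglyMeasurable measurableSet_Ioc⟩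
    · exact ((memCw_cont hk) t ht).mono_of_mem_nhdsWithin hmem
  have h1 := D hg
  have h2 := D hh
  have h3 : HasDerivWithinAt (fun u => ∫ s in a..u, g s) (h t) (Iic t) t := by
    refine h2.congr_of_eventuallyEq ?_ ?_
    · filter_upwards [Ioc_mem_nhdsLE ht.1] with u hu
      have := heq u ⟨hu.1, hu.2.trans ht.2⟩
      rwa [rl_one, rl_one] at this
    · have := heq t ht
      rwa [rl_one, rl_one] at this
  exact (uniqueDiffOn_Iic t t self_mem_Iic).eq_deriv _ h1 h3

/-- injectivity of `I^p`, `0 ≤ p ≤ 1`. -/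
lemma rl_inj {a b w p : ℝ} {g h : ℝ → ℝ} (hg : memCw a b w g) (hh : memCw a b w h) (hw : w < 1)
    (hp : 0 ≤ p) (hp1 : p ≤ 1)
    (heq : ∀ t ∈ Ioc a b, rlInt a p g t = rlInt a p h t) : ∀ t ∈ Ioc a b, g t = h t := by
  refine rl_one_inj hg hh hw fun t ht => ?_
  have h1 := rl_semigroup hg hw (sub_nonneg.2 hp1) hp ht
  have h2 := rl_semigroup hh hw (sub_nonneg.2 hp1) hp ht
  rw [sub_add_cancel] at h1 h2
  rw [← h1, ← h2]
  exact rl_congr heq ht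

/-- **Equivalence of the Hilfer IVP with a Volterra integral equation.**
Fix `a < b`, `α ∈ (0,1)`, `β ∈ [0,1]`, `γ = α + β(1−α)` (so `(1−β)(1−α) = 1−γ`).
Let `f : (a,b]×ℝ → ℝ` be such that `t ↦ f(t,z(t)) ∈ C_{1−γ}[a,b]` for every
`z ∈ C_{1−γ}[a,b]`, and let `y_a ∈ ℝ`.  Let `z ∈ C^γ_{1−γ}[a,b]`, i.e.
`z ∈ C_{1−γ}[a,b]`, `I^{1−γ}_a z` is differentiable on `(a,b]` with derivative
`D^γ_a z = Dz`, and `Dz ∈ C_{1−γ}[a,b]`.  Then `z` satisfies the IVP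
`D^{α,β}_a z(t) = I^{β(1−α)}_a Dz(t) = f(t,z(t))` on `(a,b]` together with
`lim_{t→a⁺}(I^{1−γ}_a z)(t) = y_a`, if and only if `z` satisfies the Volterra
equation `z(t) = (y_a/Γ(γ))(t−a)^{γ−1} + (1/Γ(α)) ∫_a^t (t−s)^{α−1} f(s,z(s)) ds`
on `(a,b]`. -/
theorem hilfer_ivp_iff_volterra (a b α β γ : ℝ) (hab : a < b)
    (hα0 : 0 < α) (hα1 : α < 1) (hβ0 : 0 ≤ β) (hβ1 : β ≤ 1)
    (hγ : γ = α + β * (1 - α))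
    (f : ℝ → ℝ → ℝ)
    (hf : ∀ z : ℝ → ℝ, memCw a b (1 - γ) z → memCw a b (1 - γ) (fun t => f t (z t)))
    (ya : ℝ) (z Dz : ℝ → ℝ)
    (hz : memCw a b (1 - γ) z)
    (hderiv : ∀ t ∈ Set.Ioc a b, HasDerivAt (rlInt a (1 - γ) z) (Dz t) t)
    (hDz : memCw a b (1 - γ) Dz) :
    ((∀ t ∈ Set.Ioc a b, rlInt a (β * (1 - α)) Dz t = f t (z t)) ∧
        Filter.Tendsto (rlInt a (1 - γ) z) (nhdsWithin a (Set.Ioi a)) (nhds ya)) ↔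
      (∀ t ∈ Set.Ioc a b,
        z t = ya / Real.Gamma γ * (t - a) ^ (γ - 1) +
          (1 / Real.Gamma α) * ∫ s in a..t, (t - s) ^ (α - 1) * f s (z s)) := by
  have hδ0 : 0 ≤ β * (1 - α) := mul_nonneg hβ0 (by linarith)
  have hδ1 : β * (1 - α) ≤ 1 - α := by nlinarith
  generalize β * (1 - α) = δ at *
  have hγ0 : 0 < γ := by linarith
  have hγ1 : γ ≤ 1 := by linarith
  have hw : 1 - γ < 1 := by linarith
  have hφ := hf z hz
  set φ : ℝ → ℝ := fun t => f t (z t) with hφd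
  have hI : ∀ t, (1 / Real.Gamma α) * ∫ s in a..t, (t - s) ^ (α - 1) * f s (z s) =
      rlInt a α φ t := by
    intro t
    simp only [rlInt, hα0.ne', if_false, hφd]
  simp_rw [hI]
  have hP : memCw a b (1 - γ) (fun s => ya / Real.Gamma γ * (s - a) ^ (γ - 1)) := memCw_pow
  have hIP : ∀ t ∈ Ioc a b,
      rlInt a (1 - γ) (fun s => ya / Real.Gamma γ * (s - a) ^ (γ - 1)) t = ya := by
    intro t ht
    rw [rl_pow (b := b) (by linarith) hγ0 ht]
    simp
  have hmem : ∀ {p : ℝ} {g : ℝ → ℝ}, 0 ≤ p → memCw a b (1 - γ) g →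
      memCw a b (1 - γ) (rlInt a p g) := fun hp hg =>
    memCw_mono (memCw_rlInt hab hg hw hp) (by linarith)
  have hFTC : Tendsto (rlInt a (1 - γ) z) (𝓝[>] a) (𝓝 ya) →
      ∀ t ∈ Ioc a b, rlInt a (1 - γ) z t = ya + rlInt a 1 Dz t := by
    intro hl t ht
    have := intervalIntegral.integral_eq_sub_of_hasDerivAt_of_tendsto ht.1
      (fun x hx => hderiv x ⟨hx.1, hx.2.le.trans ht.2⟩) (memCw_int1 hDz hw ht) hl
      ((hderiv t ht).continuousAt.tendsto.mono_left nhdsWithin_le_nhds)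
    rw [rl_one, this]
    ring
  constructor
  · rintro ⟨hD, hl⟩
    have hz2 := rl_inj (p := 1 - γ) hz (memCw_add hP (hmem hγ0.le hDz)) hw (by linarith)
      (by linarith) (fun t ht => by
        rw [hFTC hl t ht, rl_add hP (hmem hγ0.le hDz) hw (by linarith) ht, hIP t ht,
          rl_semigroup hDz hw (by linarith) hγ0.le ht, sub_add_cancel])
    intro t ht
    rw [hz2 t ht, hγ, ← rl_semigroup hDz hw hα0.le hδ0 ht, rl_congr hD ht]
  · intro hv
    have hF : ∀ t ∈ Ioc a b, rlInt a (1 - γ) z t = ya + rlInt a (1 - γ + α) φ t := by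
      intro t ht
      rw [rl_congr hv ht, rl_add hP (hmem hα0.le hφ) hw (by linarith) ht, hIP t ht,
          rl_semigroup hφ hw (by linarith) hα0.le ht]
    have hl : Tendsto (rlInt a (1 - γ) z) (𝓝[>] a) (𝓝 ya) := by
      have h1 := memCw_tendsto hab
        (memCw_rlInt (p := 1 - γ + α) hab hφ hw (by linarith)) (by linarith)
      have h2 := h1.const_add ya
      rw [add_zero] at h2
      refine h2.congr' ?_
      filter_upwards [Ioc_mem_nhdsGT hab] with t ht
      exact (hF t ht).symm
    refine ⟨?_, hl⟩
    refine rl_inj (p := 1 - δ) (hmem hδ0 hDz) hφ hw (by linarith) (by linarith) fun t ht => ?_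
    rw [rl_semigroup hDz hw (by linarith) hδ0 ht, sub_add_cancel]
    have h1 := hFTC hl t ht
    rw [hF t ht, show 1 - γ + α = 1 - δ by linarith] at h1
    linarith
end

section
/- Fix real numbers a < b, α ∈ (0,1), β ∈ [0,1], and set γ = α + β(1−α). Let f : (a,b]×ℝ → ℝ be continuous, such that t ↦ f(t, z(t)) belongs to C_{1−γ}[a,b] for every z ∈ C_{1−γ}[a,b], and let c, d, e ∈ ℝ with d ≠ 0 and 1 + c/d ≠ 0. Assume (H3): there exists η ∈ C_{1−γ}[a,b] such that |f(t, u)| ≤ η(t) for all t ∈ (a,b] and all u ∈ ℝ. Then there exists z ∈ C_{1−γ}[a,b] satisfying for all t ∈ (a,b] the integral equation z(t) = ((t−a)^{γ−1}/Γ(γ))·(e/(d(1+c/d))) − (1/(1+c/d))·((t−a)^{γ−1}/Γ(γ))·(1/Γ(1−γ+α)) ∫_a^b (b−s)^{α−γ} f(s, z(s)) ds + (1/Γ(α)) ∫_a^t (t−s)^{α−1} f(s, z(s)) ds; that is, the Hilfer boundary value problem D^{α,β}_a z(t) = f(t, z(t)) with c·lim_{t→a^+}(I^{1−γ}_a z)(t)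 + d·lim_{t→b^−}(I^{1−γ}_a z)(t) = e has at least one solution. -/
open MeasureTheory Set Filter Topology

namespace HilferAux

lemma beta_int (a b p q : ℝ) (hab : a < b) (hp : -1 < p) (hq : -1 < q) :
    IntervalIntegrable (fun s => (b - s) ^ p * (s - a) ^ q) volume a b := by
  have h1 : IntervalIntegrable (fun s => (s - a) ^ q) volume a ((a + b) / 2) := by
    have := (intervalIntegral.intervalIntegrable_rpow' (a := 0) (b := (a + b) / 2 - a) hq).comp_sub_right a
    simpa using this
  have h2 : IntervalIntegrable (fun s => (b - s) ^ p) volume ((a + b) / 2) b := by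
    have := (intervalIntegral.intervalIntegrable_rpow' (a := b - (a + b) / 2) (b := 0) hp).comp_sub_left b
    simpa using this
  refine IntervalIntegrable.trans (b := (a + b) / 2) ?_ ?_
  · refine h1.continuousOn_mul ?_
    rw [uIcc_of_le (by linarith)]
    refine ContinuousOn.rpow_const (by fun_prop) ?_
    intro x hx
    left
    have := hx.2
    linarith
  · refine h2.mul_continuousOn ?_
    rw [uIcc_of_le (by linarith)]
    refine ContinuousOn.rpow_const (by fun_prop) ?_
    intro x hx
    left
    have := hx.1
    linarith

/-- Truncated Riemann-Liouville kernel. -/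
noncomputable def kk (b α δ t s : ℝ) : ℝ := if s < t - δ ∧ t ≤ b then (t - s) ^ (α - 1) else 0

lemma kk_meas (b α δ : ℝ) : Measurable (Function.uncurry (kk b α δ)) := by
  unfold kk Function.uncurry
  refine Measurable.ite ?_ ?_ measurable_const
  · have h1 : MeasurableSet {x : ℝ × ℝ | x.2 < x.1 - δ} :=
      measurableSet_lt measurable_snd (measurable_fst.sub_const δ)
    have h2 : MeasurableSet {x : ℝ × ℝ | x.1 ≤ b} := measurableSet_le measurable_fst measurable_const
    exact h1.inter h2
  · fun_prop

lemma kk_meas' (b α δ t : ℝ) : Measurable (kk b α δ t) :=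
  (kk_meas b α δ).comp (measurable_const.prodMk measurable_id)

lemma kk_nonneg (b α δ t s : ℝ) (hδ : 0 ≤ δ) : 0 ≤ kk b α δ t s := by
  unfold kk
  split_ifs with h
  · exact Real.rpow_nonneg (by linarith [h.1]) _
  · exact le_rfl

lemma kk_le (b α δ t s : ℝ) (hδ : 0 ≤ δ) : kk b α δ t s ≤ kk b α 0 t s := by
  by_cases h : s < t - δ ∧ t ≤ b
  · have h' : s < t - 0 ∧ t ≤ b := ⟨by linarith [h.1], h.2⟩
    simp only [kk, if_pos h, if_pos h', le_refl]
  · have := kk_nonneg b α 0 t s le_rfl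
    simpa only [kk, if_neg h] using this

lemma kk_integral (a b α t : ℝ) (hα1 : α < 1) (ht : t ∈ Ioc a b) (g : ℝ → ℝ) :
    ∫ s in Ioc a b, kk b α 0 t s * g s = ∫ s in a..t, (t - s) ^ (α - 1) * g s := by
  rw [intervalIntegral.integral_of_le ht.1.le]
  have h : Ioc a t = Ioc a b ∩ Iic t := by
    ext x; simp only [mem_Ioc, mem_inter_iff, mem_Iic]
    have := ht.2
    constructor
    · rintro ⟨h1, h2⟩; exact ⟨⟨h1, by linarith⟩, h2⟩
    · rintro ⟨⟨h1, h3⟩, h2⟩; exact ⟨h1, h2⟩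
  rw [h, ← setIntegral_indicator measurableSet_Iic]
  congr 1
  ext s
  simp only [kk, indicator, mem_Iic, sub_zero]
  rcases lt_trichotomy s t with h | h | h
  · simp [h, h.le, ht.2]
  · subst h
    simp [Real.zero_rpow (by linarith : α - 1 ≠ 0)]
  · simp [h.not_gt, h.not_ge]

lemma kk_integrable0 (a b α γ t : ℝ) (hα0 : 0 < α) (hγ0 : 0 < γ) :
    Integrable (fun s => kk b α 0 t s * (s - a) ^ (γ - 1)) (volume.restrict (Ioc a b)) := by
  by_cases ht : t ∈ Ioc a b
  · have := beta_int a t (α - 1) (γ - 1) ht.1 (by linarith) (by linarith)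
    rw [intervalIntegrable_iff_integrableOn_Ioo_of_le ht.1.le] at this
    have h2 := (integrable_indicator_iff measurableSet_Ioo).2 this
    refine (h2.mono_measure (Measure.restrict_le_self (s := Ioc a b))).congr ?_
    filter_upwards [ae_restrict_mem measurableSet_Ioc] with s hs
    by_cases h : s < t
    · have : s ∈ Ioo a t := ⟨hs.1, h⟩
      simp [kk, h, ht.2, this]
    · have : s ∉ Ioo a t := fun h' => h h'.2
      simp [kk, h, this]
  · refine (integrable_zero ℝ ℝ _).congr ?_
    filter_upwards [ae_restrict_mem measurableSet_Ioc] with s hs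
    have : ¬ (s < t - 0 ∧ t ≤ b) := by
      rintro ⟨h1, h2⟩
      exact ht ⟨by linarith [hs.1], h2⟩
    simp only [kk, if_neg this, zero_mul]
    rfl

lemma kk_integrable (a b α γ δ t : ℝ) (hα0 : 0 < α) (hγ0 : 0 < γ) (hδ : 0 ≤ δ) :
    Integrable (fun s => kk b α δ t s * (s - a) ^ (γ - 1)) (volume.restrict (Ioc a b)) := by
  refine (kk_integrable0 a b α γ t hα0 hγ0).mono' ?_ ?_
  · exact ((kk_meas' b α δ t).mul (by fun_prop)).aestronglyMeasurable
  · filter_upwards [ae_restrict_mem measurableSet_Ioc] with s hs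
    have h1 : 0 ≤ (s - a) ^ (γ - 1) := Real.rpow_nonneg (by linarith [hs.1]) _
    rw [Real.norm_of_nonneg (mul_nonneg (kk_nonneg _ _ _ _ _ hδ) h1)]
    exact mul_le_mul_of_nonneg_right (kk_le _ _ _ _ _ hδ) h1

lemma kk_beta (a b α γ t : ℝ) (hα1 : α < 1) (ht : t ∈ Ioc a b) :
    ∫ s in Ioc a b, kk b α 0 t s * (s - a) ^ (γ - 1) =
      (t - a) ^ (α + γ - 1) * ∫ x in (0:ℝ)..1, (1 - x) ^ (α - 1) * x ^ (γ - 1) := by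
  rw [kk_integral a b α t hα1 ht]
  have hta : 0 < t - a := by linarith [ht.1]
  have := intervalIntegral.smul_integral_comp_add_mul (a := 0) (b := 1)
    (fun s => (t - s) ^ (α - 1) * (s - a) ^ (γ - 1)) (t - a) a
  simp only [mul_zero, add_zero, mul_one, add_sub_cancel, add_sub_cancel_left, smul_eq_mul] at this
  rw [← this, ← intervalIntegral.integral_const_mul, ← intervalIntegral.integral_const_mul]
  refine intervalIntegral.integral_congr ?_
  intro x hx
  rw [uIcc_of_le zero_le_one] at hx
  simp only
  rw [show t - (a + (t - a) * x) = (t - a) * (1 - x) by ring,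
    Real.mul_rpow hta.le (by linarith [hx.2]), Real.mul_rpow hta.le hx.1,
    show α + γ - 1 = 1 + (α - 1) + (γ - 1) by ring, Real.rpow_add hta, Real.rpow_add hta, Real.rpow_one]
  ring

lemma kk_equicont (a b α γ t : ℝ) (hα0 : 0 < α) (hα1 : α < 1) (hγ0 : 0 < γ) (ht : t ∈ Ioc a b) :
    Tendsto (fun t' => ∫ s in Ioc a b, |kk b α 0 t s - kk b α 0 t' s| * (s - a) ^ (γ - 1))
      (𝓝[Ioc a b] t) (𝓝 0) := by
  set ρ : ℝ → ℝ := fun s => (s - a) ^ (γ - 1) with hρ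
  set μ := volume.restrict (Ioc a b) with hμ
  have hI := fun t => kk_integrable0 a b α γ t hα0 hγ0
  have hρn : ∀ᵐ s ∂μ, 0 ≤ ρ s := by
    filter_upwards [ae_restrict_mem measurableSet_Ioc] with s hs
    exact Real.rpow_nonneg (by linarith [hs.1]) _
  have hIp : ∀ t', Integrable (fun s => max (kk b α 0 t s - kk b α 0 t' s) 0 * ρ s) μ := by
    intro t'
    refine (hI t).mono' ?_ ?_
    · refine Measurable.aestronglyMeasurable (Measurable.mul ?_ (by fun_prop))
      exact ((kk_meas' b α 0 t).sub (kk_meas' b α 0 t')).max measurable_const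
    · filter_upwards [hρn] with s hs
      rw [Real.norm_of_nonneg (mul_nonneg (le_max_right _ _) hs)]
      refine mul_le_mul_of_nonneg_right ?_ hs
      exact max_le (by linarith [kk_nonneg b α 0 t' s le_rfl]) (kk_nonneg b α 0 t s le_rfl)
  have h1 : Tendsto (fun t' => ∫ s, max (kk b α 0 t s - kk b α 0 t' s) 0 * ρ s ∂μ)
      (𝓝[Ioc a b] t) (𝓝 (∫ s, (0:ℝ) ∂μ)) := by
    refine tendsto_integral_filter_of_dominated_convergence
      (fun s => kk b α 0 t s * ρ s) ?_ ?_ (hI t) ?_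
    · exact Eventually.of_forall fun t' => (hIp t').aestronglyMeasurable
    · refine Eventually.of_forall fun t' => ?_
      filter_upwards [hρn] with s hs
      rw [Real.norm_of_nonneg (mul_nonneg (le_max_right _ _) hs)]
      refine mul_le_mul_of_nonneg_right ?_ hs
      exact max_le (by linarith [kk_nonneg b α 0 t' s le_rfl]) (kk_nonneg b α 0 t s le_rfl)
    · have hne : ∀ᵐ s ∂μ, s ≠ t := by
        have : ∀ᵐ s ∂(volume : Measure ℝ), s ≠ t := by
          simp [ae_iff]
        exact ae_restrict_of_ae this
      filter_upwards [hne] with s hs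
      have hk : Tendsto (fun t' => kk b α 0 t' s) (𝓝[Ioc a b] t) (𝓝 (kk b α 0 t s)) := by
        rcases lt_or_gt_of_ne hs with h | h
        · have e1 : kk b α 0 t s = (t - s) ^ (α - 1) := by simp [kk, h, ht.2]
          rw [e1]
          have hc : Tendsto (fun t' : ℝ => (t' - s) ^ (α - 1)) (𝓝[Ioc a b] t) (𝓝 ((t - s) ^ (α - 1))) := by
            have : ContinuousAt (fun t' : ℝ => (t' - s) ^ (α - 1)) t :=
              ContinuousAt.rpow_const (by fun_prop) (Or.inl (by linarith))
            exact this.tendsto.mono_left nhdsWithin_le_nhds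
          refine hc.congr' ?_
          filter_upwards [self_mem_nhdsWithin, nhdsWithin_le_nhds (lt_mem_nhds h)] with t' h1 h2
          simp [kk, h2, h1.2]
        · have e1 : kk b α 0 t s = 0 := by simp [kk, h.not_gt]
          rw [e1]
          refine tendsto_const_nhds.congr' ?_
          filter_upwards [nhdsWithin_le_nhds (gt_mem_nhds h)] with t' h2
          simp [kk, (show t' < s from h2).not_gt]
      have := ((tendsto_const_nhds (x := kk b α 0 t s)).sub hk).max (tendsto_const_nhds (x := (0:ℝ)))
      simpa using this.mul_const (ρ s)
  have h2 : Tendsto (fun t' => ∫ s, kk b α 0 t' s * ρ s ∂μ) (𝓝[Ioc a b] t)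
      (𝓝 (∫ s, kk b α 0 t s * ρ s ∂μ)) := by
    rw [hμ, hρ, kk_beta a b α γ t hα1 ht]
    have hc : Tendsto (fun t' : ℝ => (t' - a) ^ (α + γ - 1) *
        ∫ x in (0:ℝ)..1, (1 - x) ^ (α - 1) * x ^ (γ - 1)) (𝓝[Ioc a b] t)
        (𝓝 ((t - a) ^ (α + γ - 1) * ∫ x in (0:ℝ)..1, (1 - x) ^ (α - 1) * x ^ (γ - 1))) := by
      refine Tendsto.mul_const _ ?_
      have : ContinuousAt (fun t' : ℝ => (t' - a) ^ (α + γ - 1)) t :=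
        ContinuousAt.rpow_const (by fun_prop) (Or.inl (by linarith [ht.1]))
      exact this.tendsto.mono_left nhdsWithin_le_nhds
    refine hc.congr' ?_
    filter_upwards [self_mem_nhdsWithin] with t' h1
    exact (kk_beta a b α γ t' hα1 h1).symm
  have h3 := (h1.const_mul 2).add (h2.sub (tendsto_const_nhds (x := ∫ s, kk b α 0 t s * ρ s ∂μ)))
  simp only [integral_zero, mul_zero, sub_self, add_zero] at h3
  refine h3.congr ?_
  intro t'
  rw [← integral_sub (hI t') (hI t), ← integral_const_mul]
  refine (integral_add ((hIp t').const_mul 2) ((hI t').sub (hI t))).symm.trans ?_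
  congr 1
  ext s
  simp only [Pi.sub_apply]
  rcases le_total (kk b α 0 t s) (kk b α 0 t' s) with h | h
  · rw [max_eq_right (by linarith), abs_of_nonpos (by linarith)]; simp only [hρ]; ring
  · rw [max_eq_left (by linarith), abs_of_nonneg (by linarith)]; simp only [hρ]; ring

lemma subseq_pointwise {S : Type*} [PseudoMetricSpace S] [TopologicalSpace.SeparableSpace S] [Nonempty S]
    (w : ℕ → S → ℝ) (hb : ∀ t, ∃ D, ∀ n, |w n t| ≤ D)
    (he : ∀ t, ∀ ε > 0, ∀ᶠ t' in 𝓝 t, ∀ n, |w n t - w n t'| ≤ ε) :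
    ∃ φ : ℕ → ℕ, StrictMono φ ∧ ∃ W : S → ℝ, ∀ t, Tendsto (fun n => w (φ n) t) atTop (𝓝 (W t)) := by
  choose D hD using hb
  set q := TopologicalSpace.denseSeq S
  have hq : DenseRange q := TopologicalSpace.denseRange_denseSeq S
  have hK : IsCompact (univ.pi (fun i : ℕ => Icc (-D (q i)) (D (q i)))) :=
    isCompact_univ_pi fun i => isCompact_Icc
  obtain ⟨x, -, φ, hφ, hx⟩ := hK.tendsto_subseq (x := fun n i => w n (q i))
    (fun n i _ => abs_le.1 (hD _ _))
  refine ⟨φ, hφ, ?_⟩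
  rw [tendsto_pi_nhds] at hx
  have : ∀ t, ∃ y, Tendsto (fun n => w (φ n) t) atTop (𝓝 y) := by
    intro t
    refine cauchySeq_tendsto_of_complete ?_
    rw [Metric.cauchySeq_iff]
    intro ε hε
    obtain ⟨i, hi⟩ := hq.exists_mem_open isOpen_interior
      ⟨t, mem_interior_iff_mem_nhds.2 (he t (ε / 4) (by linarith))⟩
    have hi := interior_subset hi
    obtain ⟨N, hN⟩ := Metric.cauchySeq_iff.1 (hx i).cauchySeq (ε / 4) (by linarith)
    refine ⟨N, fun m hm n hn => ?_⟩
    have h1 := hN m hm n hn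
    have h2 := hi (φ m)
    have h3 := hi (φ n)
    simp only [Real.dist_eq, Function.comp] at *
    rw [abs_lt] at *
    rw [abs_le] at *
    constructor <;> linarith [h1.1, h1.2, h2.1, h2.2, h3.1, h3.2]
  choose W hW using this
  exact ⟨W, hW⟩

/-- Picard iterates of the truncated equation. -/
noncomputable def iter (μ : Measure ℝ) (κ F : ℝ → ℝ → ℝ) (P Q : ℝ → ℝ) (K : ℝ) : ℕ → ℝ → ℝ
  | 0 => fun t => P t + Q t * K
  | j + 1 => fun t => P t + Q t * K + ∫ s, κ t s * F s (iter μ κ F P Q K j s) ∂μ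

lemma iter_meas (μ : Measure ℝ) [SFinite μ] (κ F : ℝ → ℝ → ℝ) (P Q : ℝ → ℝ)
    (hκ : Measurable (Function.uncurry κ)) (hF : Measurable (Function.uncurry F))
    (hP : Measurable P) (hQ : Measurable Q) (K : ℝ) (j : ℕ) : Measurable (iter μ κ F P Q K j) := by
  induction j with
  | zero => exact hP.add (hQ.mul_const K)
  | succ j ih =>
    refine (hP.add (hQ.mul_const K)).add ?_
    refine StronglyMeasurable.measurable (StronglyMeasurable.integral_prod_right ?_)
    refine Measurable.stronglyMeasurable ?_
    refine hκ.mul ?_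
    exact hF.comp (measurable_snd.prodMk (ih.comp measurable_snd))

lemma iter_cont (μ : Measure ℝ) [SFinite μ] (κ F : ℝ → ℝ → ℝ) (P Q m : ℝ → ℝ)
    (hκ : Measurable (Function.uncurry κ)) (hF : Measurable (Function.uncurry F))
    (hFc : ∀ s, Continuous (F s))
    (hP : Measurable P) (hQ : Measurable Q)
    (hFb : ∀ᵐ s ∂μ, ∀ u, |F s u| ≤ m s)
    (hκi : ∀ t, Integrable (fun s => |κ t s| * m s) μ) (j : ℕ) (t : ℝ) :
    Continuous (fun K => iter μ κ F P Q K j t) := by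
  induction j generalizing t with
  | zero => simp only [iter]; fun_prop
  | succ j ih =>
    simp only [iter]
    refine Continuous.add (by fun_prop) ?_
    refine continuous_of_dominated (bound := fun s => |κ t s| * m s) ?_ ?_ (hκi t) ?_
    · intro K
      refine Measurable.aestronglyMeasurable ?_
      exact (hκ.comp (measurable_const.prodMk measurable_id)).mul
        (hF.comp (measurable_id.prodMk (iter_meas μ κ F P Q hκ hF hP hQ K j)))
    · intro K
      filter_upwards [hFb] with s hs
      rw [norm_mul]
      exact mul_le_mul_of_nonneg_left (hs _) (abs_nonneg _)
    · exact Eventually.of_forall fun s => continuous_const.mul ((hFc s).comp (ih s))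

lemma approx (μ : Measure ℝ) [SFinite μ] (κ F : ℝ → ℝ → ℝ) (P Q m l : ℝ → ℝ) (a b δ : ℝ)
    (hκ : Measurable (Function.uncurry κ)) (hF : Measurable (Function.uncurry F))
    (hFc : ∀ s, Continuous (F s))
    (hP : Measurable P) (hQ : Measurable Q) (hl : Measurable l)
    (hFb : ∀ᵐ s ∂μ, ∀ u, |F s u| ≤ m s)
    (hκi : ∀ t, Integrable (fun s => |κ t s| * m s) μ)
    (hli : Integrable (fun s => |l s| * m s) μ)
    (hδ : 0 < δ) (hκδ : ∀ t s, t - δ ≤ s → κ t s = 0) (hμa : ∀ᵐ s ∂μ, a < s) :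
    ∃ K : ℝ, ∃ z : ℝ → ℝ, |K| ≤ ∫ s, |l s| * m s ∂μ ∧ Measurable z ∧
      K = ∫ s, l s * F s (z s) ∂μ ∧
      ∀ t ≤ b, z t = P t + Q t * K + ∫ s, κ t s * F s (z s) ∂μ := by
  obtain ⟨N, hN⟩ := exists_nat_ge ((b - a) / δ)
  rw [div_le_iff₀ hδ] at hN
  set M := ∫ s, |l s| * m s ∂μ with hM
  have hbd : ∀ z : ℝ → ℝ, |∫ s, l s * F s (z s) ∂μ| ≤ M := by
    intro z
    rw [← Real.norm_eq_abs, hM]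
    refine norm_integral_le_of_norm_le hli ?_
    filter_upwards [hFb] with s hs
    rw [norm_mul]
    exact mul_le_mul_of_nonneg_left (hs _) (abs_nonneg _)
  have hM0 : 0 ≤ M := (abs_nonneg _).trans (hbd 0)
  have hcont : Continuous (fun K => ∫ s, l s * F s (iter μ κ F P Q K N s) ∂μ) := by
    refine continuous_of_dominated (bound := fun s => |l s| * m s) ?_ ?_ hli ?_
    · intro K
      refine Measurable.aestronglyMeasurable ?_
      exact hl.mul
        (hF.comp (measurable_id.prodMk (iter_meas μ κ F P Q hκ hF hP hQ K N)))
    · intro K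
      filter_upwards [hFb] with s hs
      rw [norm_mul]
      exact mul_le_mul_of_nonneg_left (hs _) (abs_nonneg _)
    · exact Eventually.of_forall fun s => continuous_const.mul ((hFc s).comp
        (iter_cont μ κ F P Q m hκ hF hFc hP hQ hFb hκi N s))
  obtain ⟨K, hK, hfix⟩ := exists_mem_Icc_isFixedPt_of_mapsTo hcont.continuousOn
    (show -M ≤ M by linarith) (fun K _ => abs_le.1 (hbd _))
  have hstab : ∀ j : ℕ, ∀ t ≤ a + j * δ, iter μ κ F P Q K (j + 1) t = iter μ κ F P Q K j t := by
    intro j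
    induction j with
    | zero =>
      intro t ht
      simp only [Nat.cast_zero, zero_mul, add_zero] at ht
      have : ∫ s, κ t s * F s (iter μ κ F P Q K 0 s) ∂μ = 0 := by
        refine integral_eq_zero_of_ae ?_
        filter_upwards [hμa] with s hs
        rw [hκδ t s (by linarith)]
        simp
      change P t + Q t * K + ∫ s, κ t s * F s (iter μ κ F P Q K 0 s) ∂μ = P t + Q t * K
      rw [this, add_zero]
    | succ j ih =>
      intro t ht
      push_cast at ht
      change P t + Q t * K + ∫ s, κ t s * F s (iter μ κ F P Q K (j + 1) s) ∂μ =
        P t + Q t * K + ∫ s, κ t s * F s (iter μ κ F P Q K j s) ∂μ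
      congr 1
      refine integral_congr_ae (Eventually.of_forall fun s => ?_)
      simp only
      by_cases h : t - δ ≤ s
      · rw [hκδ t s h]; simp
      · rw [ih s (by push Not at h; linarith)]
  refine ⟨K, iter μ κ F P Q K N, abs_le.2 hK, iter_meas μ κ F P Q hκ hF hP hQ K N, hfix.symm, ?_⟩
  intro t ht
  rw [← hstab N t (by linarith)]
  rfl

lemma core (a b α γ C g₀ : ℝ) (hab : a < b) (hα0 : 0 < α) (hα1 : α < 1) (hγ0 : 0 < γ)
    (F : ℝ → ℝ → ℝ) (P Q l : ℝ → ℝ) (hC : 0 ≤ C)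
    (hF : Measurable (Function.uncurry F)) (hFc : ∀ s, Continuous (F s))
    (hP : Measurable P) (hQ : Measurable Q) (hl : Measurable l)
    (hFb : ∀ s ∈ Ioc a b, ∀ u, |F s u| ≤ C * (s - a) ^ (γ - 1))
    (hli : Integrable (fun s => |l s| * (C * (s - a) ^ (γ - 1))) (volume.restrict (Ioc a b))) :
    ∃ z w : ℝ → ℝ, ContinuousOn w (Ioc a b) ∧
      (∃ D, ∀ t ∈ Ioc a b, |w t| ≤ D * (t - a) ^ (α + γ - 1)) ∧
      ∀ t ∈ Ioc a b, z t = P t + Q t * (∫ s in Ioc a b, l s * F s (z s)) + g₀ * w t ∧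
        w t = ∫ s in Ioc a b, kk b α 0 t s * F s (z s) := by
  set μ := volume.restrict (Ioc a b) with hμ
  have hmem : ∀ᵐ s ∂μ, s ∈ Ioc a b := ae_restrict_mem measurableSet_Ioc
  set ρ : ℝ → ℝ := fun s => (s - a) ^ (γ - 1) with hρ
  have hρn : ∀ s ∈ Ioc a b, 0 ≤ ρ s := fun s hs => Real.rpow_nonneg (by linarith [hs.1]) _
  have hFb' : ∀ᵐ s ∂μ, ∀ u, |F s u| ≤ C * ρ s := hmem.mono hFb
  have hI : ∀ δ, 0 ≤ δ → ∀ t, Integrable (fun s => kk b α δ t s * ρ s) μ :=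
    fun δ hδ t => kk_integrable a b α γ δ t hα0 hγ0 hδ
  set δ : ℕ → ℝ := fun n => 1 / ((n : ℝ) + 1) with hδdef
  have hδ : ∀ n, 0 < δ n := fun n => Nat.one_div_pos_of_nat
  have hδ0 : Tendsto δ atTop (𝓝 0) := tendsto_one_div_add_atTop_nhds_zero_nat
  have happ := fun n => approx μ (fun t s => g₀ * kk b α (δ n) t s) F P Q (fun s => C * ρ s) l a b (δ n)
    ((kk_meas b α (δ n)).const_mul g₀) hF hFc hP hQ hl hFb' (by
      intro t
      refine ((hI (δ n) (hδ n).le t).const_mul (|g₀| * C)).congr (Eventually.of_forall fun s => ?_)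
      simp only [abs_mul, abs_of_nonneg (kk_nonneg b α (δ n) t s (hδ n).le)]
      ring) hli (hδ n) (by
      intro t s h
      simp [kk, h.not_gt]) (hmem.mono fun s hs => hs.1)
  choose K z hKb hzm hKeq hzeq using happ
  set h : ℕ → ℝ → ℝ := fun n s => F s (z n s) with hh
  have hhm : ∀ n, Measurable (h n) := fun n => hF.comp (measurable_id.prodMk (hzm n))
  have hhb : ∀ n, ∀ s ∈ Ioc a b, |h n s| ≤ C * ρ s := fun n s hs => hFb s hs _
  have hkhb : ∀ n δ t, 0 ≤ δ → ∀ᵐ s ∂μ, ‖kk b α δ t s * h n s‖ ≤ C * (kk b α δ t s * ρ s) := by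
    intro n δ t hδ
    filter_upwards [hmem] with s hs
    rw [norm_mul, Real.norm_of_nonneg (kk_nonneg b α δ t s hδ)]
    calc _ ≤ kk b α δ t s * (C * ρ s) :=
          mul_le_mul_of_nonneg_left (hhb n s hs) (kk_nonneg b α δ t s hδ)
      _ = _ := by ring
  have hkhi : ∀ n δ t, 0 ≤ δ → Integrable (fun s => kk b α δ t s * h n s) μ := by
    intro n δ t hδ
    exact ((hI δ hδ t).const_mul C).mono' ((kk_meas' b α δ t).mul (hhm n)).aestronglyMeasurable
      (hkhb n δ t hδ)
  set W : ℕ → ℝ → ℝ := fun n t => ∫ s, kk b α 0 t s * h n s ∂μ with hW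
  have hWb : ∀ n t, |W n t| ≤ ∫ s, C * (kk b α 0 t s * ρ s) ∂μ := by
    intro n t
    rw [← Real.norm_eq_abs]
    exact norm_integral_le_of_norm_le ((hI 0 le_rfl t).const_mul C) (hkhb n 0 t le_rfl)
  set ω : ℝ → ℝ → ℝ := fun t t' => ∫ s, |kk b α 0 t s - kk b α 0 t' s| * ρ s ∂μ with hω
  have hωI : ∀ t t', Integrable (fun s => |kk b α 0 t s - kk b α 0 t' s| * ρ s) μ := by
    intro t t'
    refine ((hI 0 le_rfl t).sub (hI 0 le_rfl t')).abs.congr ?_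
    filter_upwards [hmem] with s hs
    simp only [Pi.sub_apply]
    rw [← sub_mul, abs_mul, abs_of_nonneg (hρn s hs)]
  have hWe : ∀ n t t', |W n t - W n t'| ≤ C * ω t t' := by
    intro n t t'
    rw [← Real.norm_eq_abs, hW, hω]
    simp only
    rw [← integral_sub (hkhi n 0 t le_rfl) (hkhi n 0 t' le_rfl), ← integral_const_mul]
    refine norm_integral_le_of_norm_le ((hωI t t').const_mul C) ?_
    filter_upwards [hmem] with s hs
    rw [← sub_mul, norm_mul]
    calc _ ≤ |kk b α 0 t s - kk b α 0 t' s| * (C * ρ s) :=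
          mul_le_mul_of_nonneg_left (hhb n s hs) (abs_nonneg _)
      _ = _ := by ring
  have hωt : ∀ t ∈ Ioc a b, Tendsto (fun t' => C * ω t t') (𝓝[Ioc a b] t) (𝓝 0) := by
    intro t ht
    simpa using (kk_equicont a b α γ t hα0 hα1 hγ0 ht).const_mul C
  -- subsequences
  obtain ⟨K', -, φ₁, hφ₁, hK'⟩ := tendsto_subseq_of_bounded
    (Metric.isBounded_Icc (-(∫ s, |l s| * (C * ρ s) ∂μ)) (∫ s, |l s| * (C * ρ s) ∂μ)) (x := K)
    (fun n => abs_le.1 (hKb n))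
  haveI : Nonempty (Ioc a b) := ⟨⟨b, hab, le_rfl⟩⟩
  obtain ⟨φ₂, hφ₂, w', hw'⟩ := subseq_pointwise (S := Ioc a b) (fun n t => W (φ₁ n) t)
    (fun t => ⟨_, fun n => hWb _ _⟩) (by
      intro t ε hε
      have := (hωt t t.2).eventually (gt_mem_nhds hε)
      have := (tendsto_nhdsWithin_iff.2 ⟨(continuous_subtype_val (p := (· ∈ Ioc a b))).tendsto t,
        Eventually.of_forall fun x => x.2⟩).eventually this
      filter_upwards [this] with t' ht' n
      exact (hWe _ _ _).trans ht'.le)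
  set φ : ℕ → ℕ := fun n => φ₁ (φ₂ n) with hφdef
  have hφ : Tendsto φ atTop atTop := hφ₁.tendsto_atTop.comp hφ₂.tendsto_atTop
  have hKφ : Tendsto (fun n => K (φ n)) atTop (𝓝 K') := hK'.comp hφ₂.tendsto_atTop
  classical
  set w : ℝ → ℝ := fun t => if ht : t ∈ Ioc a b then w' ⟨t, ht⟩ else 0 with hwdef
  have hw : ∀ t ∈ Ioc a b, Tendsto (fun n => W (φ n) t) atTop (𝓝 (w t)) := by
    intro t ht
    simp only [hwdef, dif_pos ht]
    exact hw' ⟨t, ht⟩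
  set Z : ℝ → ℝ := fun t => P t + Q t * K' + g₀ * w t with hZ
  -- convergence of truncated integrals
  have htr : ∀ t ∈ Ioc a b, Tendsto (fun n => ∫ s, kk b α (δ (φ n)) t s * h (φ n) s ∂μ) atTop
      (𝓝 (w t)) := by
    intro t ht
    have h0 : Tendsto (fun n => ∫ s, kk b α 0 t s * h (φ n) s - kk b α (δ (φ n)) t s * h (φ n) s ∂μ) atTop
        (𝓝 (∫ s, (0:ℝ) ∂μ)) := by
      refine tendsto_integral_filter_of_dominated_convergence (fun s => C * (kk b α 0 t s * ρ s))
        ?_ ?_ ((hI 0 le_rfl t).const_mul C) ?_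
      · exact Eventually.of_forall fun n =>
          ((hkhi _ 0 t le_rfl).sub (hkhi _ _ t (hδ _).le)).aestronglyMeasurable
      · refine Eventually.of_forall fun n => ?_
        filter_upwards [hmem] with s hs
        rw [← sub_mul, norm_mul, Real.norm_of_nonneg (by linarith [kk_le b α (δ (φ n)) t s (hδ _).le])]
        calc _ ≤ kk b α 0 t s * (C * ρ s) := by
              refine mul_le_mul ?_ (hhb _ s hs) (norm_nonneg _) (kk_nonneg b α 0 t s le_rfl)
              linarith [kk_nonneg b α (δ (φ n)) t s (hδ _).le]
          _ = _ := by ring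
      · refine Eventually.of_forall fun s => ?_
        refine tendsto_const_nhds.congr' ?_
        by_cases hst : s < t
        · filter_upwards [(hδ0.comp hφ).eventually (gt_mem_nhds (sub_pos.2 hst))] with n hn
          have hn' : s < t - δ (φ n) := by
            have : δ (φ n) < t - s := hn
            linarith
          simp [kk, hst, hn', ht.2]
        · refine Eventually.of_forall fun n => ?_
          have hn' : ¬ s < t - δ (φ n) := by
            have := hδ (φ n)
            push Not at hst ⊢
            linarith
          simp [kk, hst, hn']
    have h1 := (hw t ht).sub h0
    simp only [integral_zero, sub_zero] at h1
    refine h1.congr fun n => ?_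
    rw [integral_sub (hkhi _ 0 t le_rfl) (hkhi _ _ t (hδ _).le)]
    simp [hW]
  have hzlim : ∀ t ∈ Ioc a b, Tendsto (fun n => z (φ n) t) atTop (𝓝 (Z t)) := by
    intro t ht
    refine ((tendsto_const_nhds.add (hKφ.const_mul (Q t))).add ((htr t ht).const_mul g₀)).congr fun n => ?_
    rw [hzeq (φ n) t ht.2, ← integral_const_mul]
    congr 1
    refine integral_congr_ae (Eventually.of_forall fun s => ?_)
    simp only [hh]
    ring
  have hhlim : ∀ s ∈ Ioc a b, Tendsto (fun n => h (φ n) s) atTop (𝓝 (F s (Z s))) := by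
    intro s hs
    exact ((hFc s).tendsto _).comp (hzlim s hs)
  have hK'eq : K' = ∫ s, l s * F s (Z s) ∂μ := by
    refine tendsto_nhds_unique hKφ ?_
    have : Tendsto (fun n => ∫ s, l s * h (φ n) s ∂μ) atTop (𝓝 (∫ s, l s * F s (Z s) ∂μ)) := by
      refine tendsto_integral_filter_of_dominated_convergence (fun s => |l s| * (C * ρ s))
        ?_ ?_ hli ?_
      · exact Eventually.of_forall fun n => (hl.mul (hhm _)).aestronglyMeasurable
      · refine Eventually.of_forall fun n => ?_
        filter_upwards [hmem] with s hs
        rw [norm_mul]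
        exact mul_le_mul_of_nonneg_left (hhb _ s hs) (abs_nonneg _)
      · filter_upwards [hmem] with s hs
        exact (hhlim s hs).const_mul _
    exact this.congr fun n => (hKeq (φ n)).symm
  have hweq : ∀ t ∈ Ioc a b, w t = ∫ s, kk b α 0 t s * F s (Z s) ∂μ := by
    intro t ht
    refine tendsto_nhds_unique (hw t ht) ?_
    refine tendsto_integral_filter_of_dominated_convergence (fun s => C * (kk b α 0 t s * ρ s))
        ?_ ?_ ((hI 0 le_rfl t).const_mul C) ?_
    · exact Eventually.of_forall fun n => (hkhi _ 0 t le_rfl).aestronglyMeasurable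
    · exact Eventually.of_forall fun n => hkhb _ 0 t le_rfl
    · filter_upwards [hmem] with s hs
      exact (hhlim s hs).const_mul _
  refine ⟨Z, w, ?_, ⟨C * ∫ x in (0:ℝ)..1, (1 - x) ^ (α - 1) * x ^ (γ - 1), ?_⟩, ?_⟩
  · intro t ht
    refine tendsto_iff_dist_tendsto_zero.2 ?_
    refine tendsto_of_tendsto_of_tendsto_of_le_of_le' tendsto_const_nhds (hωt t ht)
      (Eventually.of_forall fun _ => dist_nonneg) ?_
    filter_upwards [self_mem_nhdsWithin] with t' ht'
    rw [dist_comm, Real.dist_eq]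
    exact le_of_tendsto ((hw t ht).sub (hw t' ht')).abs (Eventually.of_forall fun n => hWe _ _ _)
  · intro t ht
    have := le_of_tendsto (hw t ht).abs (Eventually.of_forall fun n => hWb _ _)
    rw [integral_const_mul, hμ, hρ, kk_beta a b α γ t hα1 ht] at this
    linarith
  · intro t ht
    exact ⟨by rw [← hK'eq], hweq t ht⟩

end HilferAux


/-- **Existence for the Hilfer BVP (Theorem 3.3, via Schaefer's fixed point
theorem).**  Fix `a < b`, `α ∈ (0,1)`, `β ∈ [0,1]`, `γ = α + β(1−α)`.  Let
`f : (a,b]×ℝ → ℝ` be continuous, mapping `C_{1−γ}[a,b]` into `C_{1−γ}[a,b]`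
via `z ↦ f(·,z(·))`, and let `c, d, e ∈ ℝ` with `d ≠ 0`, `1 + c/d ≠ 0`.
Assume (H3): there exists `η ∈ C_{1−γ}[a,b]` with `|f(t,u)| ≤ η(t)` for all
`t ∈ (a,b]` and `u ∈ ℝ`.  Then the equivalent integral equation of the BVP
has at least one solution `z ∈ C_{1−γ}[a,b]`. -/
theorem hilfer_bvp_existence_schaefer (a b α β γ : ℝ) (hab : a < b)
    (hα0 : 0 < α) (hα1 : α < 1) (hβ0 : 0 ≤ β) (hβ1 : β ≤ 1)
    (hγ : γ = α + β * (1 - α))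
    (f : ℝ → ℝ → ℝ)
    (hfc : ContinuousOn (fun p : ℝ × ℝ => f p.1 p.2) (Set.Ioc a b ×ˢ Set.univ))
    (hf : ∀ z : ℝ → ℝ, memCw a b (1 - γ) z → memCw a b (1 - γ) (fun t => f t (z t)))
    (c d e : ℝ) (hd : d ≠ 0) (hcd : 1 + c / d ≠ 0)
    (η : ℝ → ℝ) (hη : memCw a b (1 - γ) η)
    (hH3 : ∀ t ∈ Set.Ioc a b, ∀ u : ℝ, |f t u| ≤ η t) :
    ∃ z : ℝ → ℝ, memCw a b (1 - γ) z ∧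
      ∀ t ∈ Set.Ioc a b,
        z t = (t - a) ^ (γ - 1) / Real.Gamma γ * (e / (d * (1 + c / d))) -
            (1 / (1 + c / d)) * ((t - a) ^ (γ - 1) / Real.Gamma γ) *
              ((1 / Real.Gamma (1 - γ + α)) *
                ∫ s in a..b, (b - s) ^ (α - γ) * f s (z s)) +
            (1 / Real.Gamma α) * ∫ s in a..t, (t - s) ^ (α - 1) * f s (z s) := by
  classical
  have hγα : α ≤ γ := by rw [hγ]; nlinarith
  have hγ1 : γ ≤ 1 := by rw [hγ]; nlinarith
  have hγ0 : 0 < γ := by linarith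
  obtain ⟨H, hHc, hH⟩ := hη
  obtain ⟨C, hC⟩ := isCompact_Icc.exists_bound_of_continuousOn hHc
  have hC0 : 0 ≤ C := (norm_nonneg _).trans (hC b ⟨hab.le, le_rfl⟩)
  have hfb : ∀ s ∈ Ioc a b, ∀ u, |f s u| ≤ C * (s - a) ^ (γ - 1) := by
    intro s hs u
    have h1 := hC s (Ioc_subset_Icc_self hs)
    rw [hH s hs] at h1
    have hsa : 0 < s - a := by linarith [hs.1]
    have h2 : (s - a) ^ (1 - γ) * η s ≤ C := (le_abs_self _).trans h1
    have h3 : η s = (s - a) ^ (γ - 1) * ((s - a) ^ (1 - γ) * η s) := by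
      rw [← mul_assoc, ← Real.rpow_add hsa]; simp
    calc |f s u| ≤ η s := hH3 s hs u
      _ = (s - a) ^ (γ - 1) * ((s - a) ^ (1 - γ) * η s) := h3
      _ ≤ (s - a) ^ (γ - 1) * C := mul_le_mul_of_nonneg_left h2 (Real.rpow_nonneg hsa.le _)
      _ = _ := mul_comm _ _
  set F : ℝ → ℝ → ℝ := fun s u => if s ∈ Ioc a b then f s u else 0 with hFdef
  have hFm : Measurable (Function.uncurry F) := by
    have := ContinuousOn.measurable_piecewise (g := fun _ => (0:ℝ)) hfc continuousOn_const
      (measurableSet_Ioc.prod MeasurableSet.univ)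
    convert this using 1
    ext ⟨s, u⟩
    by_cases hs : s ∈ Ioc a b
    · rw [Set.piecewise_eq_of_mem _ _ _ (by exact ⟨hs, mem_univ _⟩)]
      simp only [hFdef, Function.uncurry, if_pos hs]
    · rw [Set.piecewise_eq_of_notMem _ _ _ (by exact fun h => hs h.1)]
      simp only [hFdef, Function.uncurry, if_neg hs]
  have hFc : ∀ s, Continuous (F s) := by
    intro s
    by_cases hs : s ∈ Ioc a b
    · simp only [hFdef, if_pos hs]
      have : ContinuousOn (fun u : ℝ => f s u) univ :=
        hfc.comp (f := fun u : ℝ => (s, u)) (by fun_prop) (fun u _ => ⟨hs, mem_univ _⟩)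
      exact continuousOn_univ.1 this
    · simp only [hFdef, if_neg hs]
      exact continuous_const
  have hFf : ∀ s ∈ Ioc a b, ∀ u, F s u = f s u := fun s hs u => if_pos hs
  have hli : Integrable (fun s => |(b - s) ^ (α - γ)| * (C * (s - a) ^ (γ - 1)))
      (volume.restrict (Ioc a b)) := by
    have := HilferAux.beta_int a b (α - γ) (γ - 1) hab (by linarith) (by linarith)
    rw [intervalIntegrable_iff_integrableOn_Ioc_of_le hab.le] at this
    refine (this.const_mul C).congr ?_
    filter_upwards [ae_restrict_mem measurableSet_Ioc] with s hs
    rw [abs_of_nonneg (Real.rpow_nonneg (by linarith [hs.2]) _)]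
    ring
  obtain ⟨z, w, hwc, ⟨D, hD⟩, hz⟩ := HilferAux.core a b α γ C (1 / Real.Gamma α) hab hα0 hα1 hγ0 F
    (fun t => (t - a) ^ (γ - 1) / Real.Gamma γ * (e / (d * (1 + c / d))))
    (fun t => -((1 / (1 + c / d)) * ((t - a) ^ (γ - 1) / Real.Gamma γ) * (1 / Real.Gamma (1 - γ + α))))
    (fun s => (b - s) ^ (α - γ)) hC0 hFm hFc (by fun_prop) (by fun_prop) (by fun_prop)
    (fun s hs u => by rw [hFf s hs]; exact hfb s hs u) hli
  refine ⟨z, ?_, ?_⟩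
  · set I := ∫ s in Ioc a b, (b - s) ^ (α - γ) * F s (z s) with hI
    set A : ℝ := 1 / Real.Gamma γ * (e / (d * (1 + c / d))) +
      -((1 / (1 + c / d)) * (1 / Real.Gamma γ) * (1 / Real.Gamma (1 - γ + α))) * I with hA
    refine ⟨fun t => A + 1 / Real.Gamma α * (if t = a then 0 else (t - a) ^ (1 - γ) * w t), ?_, ?_⟩
    · refine continuousOn_const.add (continuousOn_const.mul ?_)
      intro t ht
      rcases eq_or_lt_of_le ht.1 with h | h
      · subst h
        refine tendsto_iff_dist_tendsto_zero.2 ?_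
        have hlim : Tendsto (fun t : ℝ => |D| * (t - a) ^ α) (𝓝[Icc a b] a) (𝓝 0) := by
          have : ContinuousAt (fun t : ℝ => |D| * (t - a) ^ α) a :=
            continuousAt_const.mul (ContinuousAt.rpow_const (by fun_prop) (Or.inr hα0.le))
          have h2 := this.tendsto.mono_left (nhdsWithin_le_nhds (s := Icc a b))
          simpa [Real.zero_rpow hα0.ne'] using h2
        refine tendsto_of_tendsto_of_tendsto_of_le_of_le' tendsto_const_nhds hlim
          (Eventually.of_forall fun _ => dist_nonneg) ?_
        filter_upwards [self_mem_nhdsWithin] with t ht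
        rw [if_pos rfl, Real.dist_eq, sub_zero]
        rcases eq_or_lt_of_le ht.1 with h | h
        · rw [if_pos h.symm, abs_zero]
          exact mul_nonneg (abs_nonneg _) (Real.rpow_nonneg (by linarith) _)
        · have hta : 0 < t - a := by linarith
          rw [if_neg h.ne', abs_mul, abs_of_nonneg (Real.rpow_nonneg hta.le _)]
          calc _ ≤ (t - a) ^ (1 - γ) * (|D| * (t - a) ^ (α + γ - 1)) := by
                refine mul_le_mul_of_nonneg_left ((hD t ⟨h, ht.2⟩).trans ?_) (Real.rpow_nonneg hta.le _)
                exact mul_le_mul_of_nonneg_right (le_abs_self _) (Real.rpow_nonneg hta.le _)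
            _ = |D| * ((t - a) ^ (1 - γ) * (t - a) ^ (α + γ - 1)) := by ring
            _ = _ := by
                rw [← Real.rpow_add hta]; congr 2; ring
      · have h1 : ContinuousWithinAt (fun t => (t - a) ^ (1 - γ) * w t) (Ioc a b) t := by
          refine ContinuousWithinAt.mul ?_ (hwc t ⟨h, ht.2⟩)
          exact (ContinuousAt.rpow_const (by fun_prop) (Or.inl (by linarith))).continuousWithinAt
        have h2 : ContinuousWithinAt (fun t => (t - a) ^ (1 - γ) * w t) (Icc a b) t := by
          refine h1.mono_of_mem_nhdsWithin ?_
          filter_upwards [self_mem_nhdsWithin, nhdsWithin_le_nhds (lt_mem_nhds h)] with x hx hx'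
          exact ⟨hx', hx.2⟩
        refine h2.congr_of_eventuallyEq ?_ (if_neg h.ne')
        filter_upwards [nhdsWithin_le_nhds (lt_mem_nhds h)] with x hx
        exact if_neg (ne_of_gt hx)
    · intro t ht
      have hta : 0 < t - a := by linarith [ht.1]
      have hone : (t - a) ^ (1 - γ) * (t - a) ^ (γ - 1) = 1 := by
        rw [← Real.rpow_add hta]; simp
      simp only [if_neg ht.1.ne']
      rw [(hz t ht).1, hA]
      linear_combination (-(1 / Real.Gamma γ * (e / (d * (1 + c / d))) +
        -((1 / (1 + c / d)) * (1 / Real.Gamma γ) * (1 / Real.Gamma (1 - γ + α))) * I)) * hone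
  · intro t ht
    have e1 : ∫ s in Ioc a b, (b - s) ^ (α - γ) * F s (z s) = ∫ s in a..b, (b - s) ^ (α - γ) * f s (z s) := by
      rw [intervalIntegral.integral_of_le hab.le]
      refine setIntegral_congr_fun measurableSet_Ioc fun s hs => ?_
      simp only [hFf s hs]
    have e2 : w t = ∫ s in a..t, (t - s) ^ (α - 1) * f s (z s) := by
      rw [(hz t ht).2, ← HilferAux.kk_integral a b α t hα1 ht]
      refine setIntegral_congr_fun measurableSet_Ioc fun s hs => ?_
      simp only [hFf s hs]
    have := (hz t ht).1
    rw [e1, e2] at this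
    rw [this]
    ring
end
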